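/- Let k ∈ ℕ, let f_1, …, f_k : ℝ → ℝ be real analytic functions such that {1, f_1, …, f_k} is linearly independent over ℝ, and let I ⊂ ℝ be a compact interval. Then there exist constants C, δ > 0 such that for every nonzero λ = (λ_1, …, λ_k) ∈ ℝ^k, |∫_I e(λ_1 f_1(x) + ⋯ + λ_k f_k(x)) dx| ≤ C‖λ‖^{−δ}. -/

import Mathlib

open Filter MeasureTheory
open scoped Topology


/-- Integration by parts for an oscillatory integral without stationary points. -/
theorem norm_integral_exp_le_of_le_abs_deriv {g : ℝ → ℝ} (hg : ContDiff ℝ 2 g)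
    {p q t ε M : ℝ} (hpq : p ≤ q) (ht : 0 < t) (hε : 0 < ε)
    (hM : ∀ x ∈ Set.Icc p q, |iteratedDeriv 2 g x| ≤ M)
    (hlow : ∀ x ∈ Set.Icc p q, ε ≤ |deriv g x|) :
    ‖∫ x in p..q, Complex.exp (Complex.I * (t * g x : ℝ))‖ ≤
      2 / (t * ε) + M / (t * ε ^ 2) * (q - p) := by
  have hg1 : Differentiable ℝ g := hg.differentiable (by norm_num)
  have hg2 : Differentiable ℝ (deriv g) := by
    have := hg.differentiable_iteratedDeriv 1 (by norm_num)
    rwa [iteratedDeriv_one] at this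
  have hcont2 : Continuous (iteratedDeriv 2 g) := hg.continuous_iteratedDeriv 2 le_rfl
  have hd2 : ∀ x, HasDerivAt (deriv g) (iteratedDeriv 2 g x) x := fun x => by
    have := (hg2 x).hasDerivAt
    rwa [← iteratedDeriv_one (f := g), ← iteratedDeriv_succ, iteratedDeriv_one] at this
  set v : ℝ → ℂ := fun x => Complex.exp (Complex.I * (t * g x : ℝ)) with hv
  have hvn : ∀ x, ‖v x‖ = 1 := fun x => by
    simp only [hv]
    rw [mul_comm]
    exact Complex.norm_exp_ofReal_mul_I _
  have hvd : ∀ x, HasDerivAt v (v x * (Complex.I * (t * deriv g x : ℝ))) x := fun x =>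
    ((((hg1 x).hasDerivAt.const_mul t).ofReal_comp).const_mul Complex.I).cexp
  have hvc : Continuous v := continuous_iff_continuousAt.2 fun x => (hvd x).continuousAt
  have hne : ∀ x ∈ Set.Icc p q, deriv g x ≠ 0 := fun x hx h0 => by
    have := hlow x hx
    rw [h0, abs_zero] at this
    linarith
  set W : ℝ → ℂ := fun x => v x / (Complex.I * (t * deriv g x : ℝ)) with hW
  set R : ℝ → ℂ := fun x => v x * ((iteratedDeriv 2 g x : ℝ) : ℂ) /
    (Complex.I * t * ((deriv g x : ℝ) : ℂ) ^ 2) with hR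
  have hWd : ∀ x ∈ Set.Icc p q, HasDerivAt W (v x - R x) x := fun x hx => by
    have hne' : ((deriv g x : ℝ) : ℂ) ≠ 0 := by exact_mod_cast hne x hx
    have htc : (t : ℂ) ≠ 0 := by exact_mod_cast ht.ne'
    have hden : Complex.I * ((t * deriv g x : ℝ) : ℂ) ≠ 0 := by
      push_cast
      exact mul_ne_zero Complex.I_ne_zero (mul_ne_zero htc hne')
    have h := (hvd x).div ((((hd2 x).const_mul t).ofReal_comp).const_mul Complex.I) hden
    refine h.congr_deriv ?_
    simp only [hR]
    push_cast
    have := Complex.I_ne_zero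
    field_simp
  have hRc : ContinuousOn R (Set.Icc p q) := by
    refine ContinuousOn.div (by fun_prop) ?_ ?_
    · have := hg2.continuous
      fun_prop
    · intro x hx
      have hne' : ((deriv g x : ℝ) : ℂ) ≠ 0 := by exact_mod_cast hne x hx
      have htc : (t : ℂ) ≠ 0 := by exact_mod_cast ht.ne'
      exact mul_ne_zero (mul_ne_zero Complex.I_ne_zero htc) (pow_ne_zero _ hne')
  rw [← Set.uIcc_of_le hpq] at hWd hRc
  have hRi : IntervalIntegrable R volume p q := hRc.intervalIntegrable
  have hvi : IntervalIntegrable v volume p q := hvc.intervalIntegrable _ _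
  have key := intervalIntegral.integral_eq_sub_of_hasDerivAt hWd (hvi.sub hRi)
  rw [intervalIntegral.integral_sub hvi hRi] at key
  have hWn : ∀ x ∈ Set.Icc p q, ‖W x‖ ≤ 1 / (t * ε) := fun x hx => by
    rw [hW]
    simp only [norm_div, norm_mul, hvn, Complex.norm_I, one_mul, Complex.norm_real,
      Real.norm_eq_abs, abs_of_pos ht]
    gcongr
    exact hlow x hx
  have hRn : ∀ x ∈ Set.Icc p q, ‖R x‖ ≤ M / (t * ε ^ 2) := fun x hx => by
    rw [hR]
    simp only [norm_div, norm_mul, hvn, Complex.norm_I, one_mul, Complex.norm_real,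
      Real.norm_eq_abs, abs_of_pos ht, norm_pow]
    have := hlow x hx
    have := (abs_nonneg _).trans (hM x hx)
    gcongr
    exact hM x hx
  have hRint : ‖∫ x in p..q, R x‖ ≤ M / (t * ε ^ 2) * |q - p| :=
    intervalIntegral.norm_integral_le_of_norm_le_const fun x hx => by
      rw [Set.uIoc_of_le hpq] at hx
      exact hRn x (Set.Ioc_subset_Icc_self hx)
  rw [abs_of_nonneg (sub_nonneg.2 hpq)] at hRint
  have hsum : ∫ x in p..q, v x = W q - W p + ∫ x in p..q, R x := by rw [← key]; ring
  rw [hsum]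
  calc _ ≤ ‖W q‖ + ‖W p‖ + ‖∫ x in p..q, R x‖ :=
        (norm_add_le _ _).trans (by gcongr; exact norm_sub_le _ _)
    _ ≤ 1 / (t * ε) + 1 / (t * ε) + M / (t * ε ^ 2) * (q - p) := by
        gcongr
        exacts [hWn q ⟨hpq, le_rfl⟩, hWn p ⟨le_rfl, hpq⟩]
    _ = _ := by ring

/-- A function whose derivative is bounded away from zero on an interval grows at least linearly
away from a minimum point of its absolute value. -/
theorem exists_mul_abs_sub_le_abs {h h' : ℝ → ℝ} (hd : ∀ x, HasDerivAt h (h' x) x)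
    {p q ε : ℝ} (hpq : p ≤ q) (hlow : ∀ x ∈ Set.Icc p q, ε ≤ |h' x|) :
    ∃ c ∈ Set.Icc p q, ∀ x ∈ Set.Icc p q, ε * |x - c| ≤ |h x| := by
  have hc : Continuous h := continuous_iff_continuousAt.2 fun x => (hd x).continuousAt
  obtain ⟨c, hcm, hmin⟩ := isCompact_Icc.exists_isMinOn (Set.nonempty_Icc.2 hpq)
    (hc.abs.continuousOn (s := Set.Icc p q))
  refine ⟨c, hcm, fun x hx => ?_⟩
  have hle : |h c| ≤ |h x| := hmin hx
  have hmvt : ε * |x - c| ≤ |h x - h c| := by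
    have aux : ∀ y ∈ Set.Icc p q, ∀ z ∈ Set.Icc p q, y < z → ε * |z - y| ≤ |h z - h y| := by
      intro y hy z hz hyz
      obtain ⟨ξ, hξ, he⟩ := exists_hasDerivAt_eq_slope h h' hyz hc.continuousOn fun w _ => hd w
      have hpos : 0 < z - y := sub_pos.2 hyz
      have : h z - h y = h' ξ * (z - y) := by rw [he]; field_simp
      rw [this, abs_mul]
      gcongr
      exact hlow ξ ⟨hy.1.trans hξ.1.le, hξ.2.le.trans hz.2⟩
    rcases lt_trichotomy x c with hlt | rfl | hlt
    · rw [abs_sub_comm, abs_sub_comm (h x)]; exact aux x hx c hcm hlt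
    · simp
    · exact aux c hcm x hx hlt
  refine hmvt.trans ?_
  have hsign : 0 ≤ h x * h c := by
    by_contra! hneg
    have hzero : (0 : ℝ) ∈ Set.uIcc (h c) (h x) := by
      rcases mul_neg_iff.1 hneg with ⟨h1, h2⟩ | ⟨h1, h2⟩
      · exact Set.mem_uIcc.2 (Or.inl ⟨h2.le, h1.le⟩)
      · exact Set.mem_uIcc.2 (Or.inr ⟨h1.le, h2.le⟩)
    obtain ⟨z, hz, hz0⟩ := intermediate_value_uIcc (hc.continuousOn (s := Set.uIcc c x)) hzero
    have : |h c| ≤ |h z| := hmin (Set.uIcc_subset_Icc hcm hx hz)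
    rw [hz0, abs_zero] at this
    have : h c = 0 := abs_nonpos_iff.1 this
    simp [this] at hneg
  rcases abs_cases (h x) with ⟨e1, s1⟩ | ⟨e1, s1⟩ <;>
    rcases abs_cases (h c) with ⟨e2, s2⟩ | ⟨e2, s2⟩ <;>
    rw [e1, e2] at hle <;> rw [e1, abs_le] <;> constructor <;> nlinarith

/-- A van der Corput type estimate, uniform in the phase, under a lower bound on the derivative of
order `n + 1` and an upper bound on the second derivative. -/
theorem exists_norm_integral_exp_le_of_le_abs_iteratedDeriv (a b M : ℝ) (hM0 : 0 ≤ M) (n : ℕ) :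
    ∃ C > (0 : ℝ), ∃ δ > (0 : ℝ), ∀ g : ℝ → ℝ, (∀ m : ℕ, ContDiff ℝ m g) →
      (∀ x ∈ Set.Icc a b, |iteratedDeriv 2 g x| ≤ M) →
      ∀ t ≥ (1 : ℝ), ∀ ε > (0 : ℝ), ε ≤ 1 → ∀ p q : ℝ, a ≤ p → p ≤ q → q ≤ b →
      (∀ x ∈ Set.Icc p q, ε ≤ |iteratedDeriv (n + 1) g x|) →
      ‖∫ x in p..q, Complex.exp (Complex.I * (t * g x : ℝ))‖ ≤ C * t ^ (-δ) / ε ^ 2 := by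
  induction n with
  | zero =>
    refine ⟨2 + M * |b - a|, by positivity, 1, one_pos, ?_⟩
    intro g hg hM t ht ε hε hε1 p q hap hpq hqb hlow
    have ht0 : 0 < t := by linarith
    simp only [zero_add, iteratedDeriv_one] at hlow
    refine (norm_integral_exp_le_of_le_abs_deriv (hg 2) hpq ht0 hε
      (fun x hx => hM x ⟨hap.trans hx.1, hx.2.trans hqb⟩) hlow).trans ?_
    rw [Real.rpow_neg_one]
    have h1 : 2 / (t * ε) ≤ 2 / (t * ε ^ 2) := by
      gcongr
      nlinarith
    have h2 : M / (t * ε ^ 2) * (q - p) ≤ M / (t * ε ^ 2) * |b - a| := by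
      gcongr
      exact le_trans (by linarith) (le_abs_self _)
    calc _ ≤ 2 / (t * ε ^ 2) + M / (t * ε ^ 2) * |b - a| := add_le_add h1 h2
      _ = _ := by field_simp
  | succ n ih =>
    obtain ⟨C, hC, δ, hδ, ih⟩ := ih
    refine ⟨2 + 2 * C, by positivity, δ / 4, by positivity, ?_⟩
    intro g hg hM t ht ε hε hε1 p q hap hpq hqb hlow
    have ht0 : 0 < t := by linarith
    obtain ⟨c, hc, hgrow⟩ := exists_mul_abs_sub_le_abs (h := iteratedDeriv (n + 1) g)
      (h' := iteratedDeriv (n + 1 + 1) g) (fun x => by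
        have := ((hg (n + 2)).differentiable_iteratedDeriv (n + 1)
          (by exact_mod_cast Nat.lt_succ_self _)) x
        rw [iteratedDeriv_succ (n := n + 1)]
        exact this.hasDerivAt) hpq hlow
    set η : ℝ := t ^ (-(δ / 4)) with hη
    have hη0 : 0 < η := Real.rpow_pos_of_pos ht0 _
    have hη1 : η ≤ 1 := Real.rpow_le_one_of_one_le_of_nonpos ht (by linarith)
    have hηδ : t ^ (-δ) = η ^ 4 := by
      rw [hη, ← Real.rpow_natCast, ← Real.rpow_mul ht0.le]
      congr 1
      push_cast
      ring
    set r : ℝ := η / ε with hr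
    have hr0 : 0 < r := by positivity
    have hfar : ∀ x ∈ Set.Icc p q, r ≤ |x - c| → η ≤ |iteratedDeriv (n + 1) g x| := by
      intro x hx hxr
      refine le_trans ?_ (hgrow x hx)
      calc η = ε * r := by rw [hr]; field_simp
        _ ≤ _ := by gcongr
    set v : ℝ → ℂ := fun x => Complex.exp (Complex.I * (t * g x : ℝ)) with hv
    have hvn : ∀ x, ‖v x‖ = 1 := fun x => by
      simp only [hv]
      rw [mul_comm]
      exact Complex.norm_exp_ofReal_mul_I _
    have hvc : Continuous v := by
      have := (hg 0).continuous
      fun_prop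
    have hvi : ∀ x y, IntervalIntegrable v volume x y := fun x y => hvc.intervalIntegrable _ _
    obtain ⟨u, hpu, huc, hu, hul⟩ : ∃ u, p ≤ u ∧ u ≤ c ∧ c - r ≤ u ∧
        ∀ x ∈ Set.Icc p u, p < u → r ≤ |x - c| := by
      refine ⟨max p (c - r), le_max_left _ _, max_le hc.1 (by linarith), le_max_right _ _, ?_⟩
      intro x hx hlt
      have h1 : p < c - r := (lt_max_iff.1 hlt).resolve_left (lt_irrefl p)
      rw [max_eq_right h1.le] at hx
      rw [abs_sub_comm]
      exact le_trans (by linarith [hx.2]) (le_abs_self _)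
    obtain ⟨w, hwq, hcw, hw, hwl⟩ : ∃ w, w ≤ q ∧ c ≤ w ∧ w ≤ c + r ∧
        ∀ x ∈ Set.Icc w q, w < q → r ≤ |x - c| := by
      refine ⟨min q (c + r), min_le_left _ _, le_min hc.2 (by linarith), min_le_right _ _, ?_⟩
      intro x hx hlt
      have h1 : c + r < q := by simpa using hlt
      rw [min_eq_right h1.le] at hx
      exact le_trans (by linarith [hx.1]) (le_abs_self _)
    have hside : ∀ y z, p ≤ y → y ≤ z → z ≤ q → (∀ x ∈ Set.Icc y z, y < z → r ≤ |x - c|) →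
        ‖∫ x in y..z, v x‖ ≤ C * η ^ 2 := by
      intro y z hpy hyz hzq hyzr
      rcases hyz.eq_or_lt with rfl | hlt
      · simp only [intervalIntegral.integral_same, norm_zero]
        positivity
      · have := ih g hg hM t ht η hη0 hη1 y z (hap.trans hpy) hyz (hzq.trans hqb)
          fun x hx => hfar x ⟨hpy.trans hx.1, hx.2.trans hzq⟩ (hyzr x hx hlt)
        rw [hηδ] at this
        refine this.trans (le_of_eq ?_)
        field_simp
    have hmid : ‖∫ x in u..w, v x‖ ≤ 2 * r := by
      have := intervalIntegral.norm_integral_le_of_norm_le_const (a := u) (b := w) (f := v)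
        fun x _ => (hvn x).le
      rw [abs_of_nonneg (by linarith)] at this
      linarith
    have hL := hside p u le_rfl hpu (huc.trans hc.2) hul
    have hR := hside w q (hc.1.trans hcw) hwq le_rfl hwl
    rw [← intervalIntegral.integral_add_adjacent_intervals (hvi p u) (hvi u q),
      ← intervalIntegral.integral_add_adjacent_intervals (hvi u w) (hvi w q)]
    have htri := (norm_add_le (∫ x in p..u, v x) ((∫ x in u..w, v x) + ∫ x in w..q, v x)).trans
      (add_le_add_right (norm_add_le _ _) _)
    refine htri.trans ?_
    rw [le_div_iff₀ (by positivity)]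
    have e1 : r * ε ^ 2 = η * ε := by rw [hr]; field_simp
    have e2 : η * ε ≤ η := mul_le_of_le_one_right hη0.le hε1
    have e3 : η ^ 2 * ε ^ 2 ≤ η := by
      calc η ^ 2 * ε ^ 2 ≤ η ^ 2 * 1 := by gcongr; exact pow_le_one₀ hε.le hε1
        _ ≤ η := by nlinarith
    calc _ ≤ (C * η ^ 2 + (2 * r + C * η ^ 2)) * ε ^ 2 := by gcongr
      _ = 2 * (r * ε ^ 2) + 2 * C * (η ^ 2 * ε ^ 2) := by ring
      _ ≤ 2 * η + 2 * C * η := by rw [e1]; gcongr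
      _ = _ := by ring

/-- A real analytic function all of whose derivatives of positive order vanish at one point is
constant. -/
theorem eq_of_forall_iteratedDeriv_succ_eq_zero {g : ℝ → ℝ} (hg : ∀ x, AnalyticAt ℝ g x) (x₀ : ℝ)
    (h0 : ∀ n : ℕ, iteratedDeriv (n + 1) g x₀ = 0) (x y : ℝ) : g x = g y := by
  have hd : AnalyticOnNhd ℝ (deriv g) Set.univ := fun z _ => (hg z).deriv
  have hev : deriv g =ᶠ[𝓝 x₀] 0 := by
    have hs := (hg x₀).deriv.hasFPowerSeriesAt
    have hz : (FormalMultilinearSeries.ofScalars ℝ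
        fun n => iteratedDeriv n (deriv g) x₀ / (n.factorial : ℝ)) = 0 := by
      simp only [← iteratedDeriv_succ', h0, zero_div]
      ext n
      simp [FormalMultilinearSeries.ofScalars]
    rw [hz] at hs
    exact hs.eventually_eq_zero
  have heq := hd.eqOn_of_preconnected_of_eventuallyEq (fun z _ => analyticAt_const)
    isPreconnected_univ (Set.mem_univ x₀) hev
  exact is_const_of_deriv_eq_zero (fun z => (hg z).differentiableAt)
    (fun z => heq (Set.mem_univ z)) x y

/-- Bounds on short intervals add up to a bound on a long interval. -/
theorem norm_integral_le_of_short {v : ℝ → ℂ} (hv : Continuous v) {a b ρ D : ℝ} (hρ : 0 ≤ ρ)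
    (h : ∀ p q, a ≤ p → p ≤ q → q ≤ b → q - p ≤ ρ → ‖∫ x in p..q, v x‖ ≤ D) (n : ℕ) :
    ∀ p, a ≤ p → p ≤ b → b - p ≤ n * ρ → ‖∫ x in p..b, v x‖ ≤ n * D := by
  induction n with
  | zero =>
    intro p hap hpb hlen
    have : p = b := le_antisymm hpb (by simpa using hlen)
    simp [this]
  | succ n ih =>
    intro p hap hpb hlen
    push_cast at hlen ⊢
    set u := min (p + ρ) b with hu
    have hpu : p ≤ u := le_min (by linarith) hpb
    have h1 := h p u hap hpu (min_le_right _ _) (by linarith [min_le_left (p + ρ) b])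
    have h2 : ‖∫ x in u..b, v x‖ ≤ n * D := by
      refine ih u (hap.trans hpu) (min_le_right _ _) ?_
      rcases min_cases (p + ρ) b with ⟨e, _⟩ | ⟨e, _⟩
      · rw [hu, e]; linarith
      · rw [hu, e, sub_self]; positivity
    rw [← intervalIntegral.integral_add_adjacent_intervals (hv.intervalIntegrable p u)
      (hv.intervalIntegrable u b)]
    refine (norm_add_le _ _).trans ?_
    linarith

theorem stmt15 (k : ℕ) (f : Fin k → ℝ → ℝ) (hf : ∀ i, ∀ x : ℝ, AnalyticAt ℝ (f i) x)
    (hindep : ∀ (c : Fin k → ℝ) (d : ℝ), (∀ x : ℝ, ∑ i, c i * f i x = d) → c = 0)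
    (a b : ℝ) (hab : a ≤ b) :
    ∃ C > (0 : ℝ), ∃ δ > (0 : ℝ), ∀ lam : EuclideanSpace ℝ (Fin k), lam ≠ 0 →
      ‖∫ x in a..b, Complex.exp (2 * Real.pi * Complex.I * ((∑ i, lam i * f i x : ℝ) : ℂ))‖ ≤
        C * ‖lam‖ ^ (-δ) := by
  have hfs : ∀ i, ∀ m : ℕ, ContDiff ℝ m (f i) := fun i m =>
    AnalyticOnNhd.contDiff fun x _ => hf i x
  set G : EuclideanSpace ℝ (Fin k) → ℝ → ℝ := fun μ x => ∑ i, μ i * f i x with hG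
  have hGs : ∀ μ, ∀ m : ℕ, ContDiff ℝ m (G μ) := fun μ m =>
    ContDiff.sum fun i _ => contDiff_const.mul (hfs i m)
  have hGa : ∀ μ x, AnalyticAt ℝ (G μ) x := fun μ x =>
    Finset.analyticAt_fun_sum _ fun i _ => analyticAt_const.mul (hf i x)
  have hGd : ∀ n μ x, iteratedDeriv n (G μ) x = ∑ i, μ i * iteratedDeriv n (f i) x := by
    intro n μ x
    rw [hG, iteratedDeriv_fun_sum fun i _ => (contDiff_const.mul (hfs i n)).contDiffAt]
    exact Finset.sum_congr rfl fun i _ => iteratedDeriv_const_mul_field _ _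
  have hGc : ∀ n, Continuous fun z : EuclideanSpace ℝ (Fin k) × ℝ =>
      iteratedDeriv n (G z.1) z.2 := by
    intro n
    simp only [hGd]
    have := fun i => (hfs i n).continuous_iteratedDeriv n le_rfl
    fun_prop
  set S : Set (EuclideanSpace ℝ (Fin k)) := Metric.sphere 0 1 with hS
  have hK : IsCompact (S ×ˢ Set.Icc a b) := (isCompact_sphere _ _).prod isCompact_Icc
  obtain ⟨M, hM⟩ := hK.exists_bound_of_continuousOn (hGc 2).continuousOn
  have hM' : ∀ μ ∈ S, ∀ x ∈ Set.Icc a b, |iteratedDeriv 2 (G μ) x| ≤ max M 0 :=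
    fun μ hμ x hx => (hM (μ, x) ⟨hμ, hx⟩).trans (le_max_left _ _)
  have hlocal : ∃ C > (0 : ℝ), ∃ δ > (0 : ℝ), ∃ ρ > (0 : ℝ), ∀ z ∈ S ×ˢ Set.Icc a b, z.1 ∈ S →
      ∀ p q, a ≤ p → p ≤ q → q ≤ b → |p - z.2| ≤ ρ → |q - z.2| ≤ ρ → ∀ t ≥ (1 : ℝ),
      ‖∫ x in p..q, Complex.exp (Complex.I * (t * G z.1 x : ℝ))‖ ≤ C * t ^ (-δ) := by
    refine hK.induction_on (p := fun s => ∃ C > (0 : ℝ), ∃ δ > (0 : ℝ), ∃ ρ > (0 : ℝ), ∀ z ∈ s,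
      z.1 ∈ S → ∀ p q, a ≤ p → p ≤ q → q ≤ b → |p - z.2| ≤ ρ → |q - z.2| ≤ ρ → ∀ t ≥ (1 : ℝ),
      ‖∫ x in p..q, Complex.exp (Complex.I * (t * G z.1 x : ℝ))‖ ≤ C * t ^ (-δ)) ?_ ?_ ?_ ?_
    · exact ⟨1, one_pos, 1, one_pos, 1, one_pos, by simp⟩
    · rintro s s' hss ⟨C, hC, δ, hδ, ρ, hρ, h⟩
      exact ⟨C, hC, δ, hδ, ρ, hρ, fun z hz => h z (hss hz)⟩
    · rintro s s' ⟨C, hC, δ, hδ, ρ, hρ, h⟩ ⟨C', hC', δ', hδ', ρ', hρ', h'⟩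
      refine ⟨max C C', by positivity, min δ δ', by positivity, min ρ ρ', by positivity, ?_⟩
      rintro z (hz | hz) hzS p q hap hpq hqb hp hq t ht
      · refine (h z hz hzS p q hap hpq hqb (hp.trans (min_le_left _ _))
          (hq.trans (min_le_left _ _)) t ht).trans ?_
        gcongr
        exacts [le_max_left _ _, min_le_left _ _]
      · refine (h' z hz hzS p q hap hpq hqb (hp.trans (min_le_right _ _))
          (hq.trans (min_le_right _ _)) t ht).trans ?_
        gcongr
        exacts [le_max_right _ _, min_le_right _ _]
    · rintro ⟨μ, x⟩ ⟨hμ, -⟩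
      obtain ⟨n, hn⟩ : ∃ n : ℕ, iteratedDeriv (n + 1) (G μ) x ≠ 0 := by
        by_contra! h0
        have hconst := eq_of_forall_iteratedDeriv_succ_eq_zero (hGa μ) x h0
        have hμ0 := hindep (fun i => μ i) (G μ 0) fun y => hconst y 0
        have : μ = 0 := by
          ext i
          exact congrFun hμ0 i
        simp [hS, this] at hμ
      obtain ⟨C, hC, δ, hδ, hvdc⟩ :=
        exists_norm_integral_exp_le_of_le_abs_iteratedDeriv a b (max M 0) (le_max_right _ _) n
      set ε : ℝ := min 1 (|iteratedDeriv (n + 1) (G μ) x| / 2) with hε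
      have hpos : 0 < |iteratedDeriv (n + 1) (G μ) x| := abs_pos.2 hn
      have hε0 : 0 < ε := by positivity
      have hopen : ∀ᶠ z : EuclideanSpace ℝ (Fin k) × ℝ in 𝓝 (μ, x),
          ε < |iteratedDeriv (n + 1) (G z.1) z.2| :=
        (hGc (n + 1)).abs.continuousAt.eventually_const_lt
          ((min_le_right _ _).trans_lt (half_lt_self hpos))
      obtain ⟨ρ, hρ, hball⟩ := Metric.eventually_nhds_iff.1 hopen
      refine ⟨Metric.ball (μ, x) (ρ / 2), mem_nhdsWithin_of_mem_nhds
        (Metric.ball_mem_nhds _ (by positivity)), C / ε ^ 2, by positivity, δ, hδ, ρ / 4,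
        by positivity, ?_⟩
      rintro ⟨ν, y⟩ hz hν p q hap hpq hqb hp hq t ht
      refine (hvdc (G ν) (hGs ν) (hM' ν hν) t ht ε hε0 (min_le_left _ _) p q hap hpq hqb
        fun w hw => ?_).trans (le_of_eq (by ring))
      refine (hball (y := (ν, w)) ?_).le
      rw [Metric.mem_ball, Prod.dist_eq, max_lt_iff, Real.dist_eq] at hz
      rw [Prod.dist_eq, max_lt_iff, Real.dist_eq]
      refine ⟨hz.1.trans (by linarith), ?_⟩
      have h1 := abs_lt.1 hz.2
      have h2 := abs_le.1 hp
      have h3 := abs_le.1 hq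
      simp only at h1 h2 h3
      rw [abs_lt]
      constructor <;> linarith [hw.1, hw.2]
  obtain ⟨C, hC, δ, hδ, ρ, hρ, hloc⟩ := hlocal
  obtain ⟨N, hN⟩ := exists_nat_ge ((b - a) / ρ)
  have hNρ : b - a ≤ N * ρ := (div_le_iff₀ hρ).1 hN
  refine ⟨N * C + (b - a) + 1, by have := sub_nonneg.2 hab; positivity, δ, hδ, ?_⟩
  intro lam hlam
  have hl : 0 < ‖lam‖ := norm_pos_iff.2 hlam
  have hba := sub_nonneg.2 hab
  have hpow : 0 < ‖lam‖ ^ (-δ) := Real.rpow_pos_of_pos hl _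
  rcases le_total ‖lam‖ 1 with hle | hge
  · have hone : 1 ≤ ‖lam‖ ^ (-δ) :=
      Real.one_le_rpow_of_pos_of_le_one_of_nonpos hl hle (by linarith)
    have htriv := intervalIntegral.norm_integral_le_of_norm_le_const (a := a) (b := b) (C := 1)
      (f := fun x => Complex.exp (2 * Real.pi * Complex.I * ((∑ i, lam i * f i x : ℝ) : ℂ)))
      fun x _ => by
        rw [show 2 * Real.pi * Complex.I * ((∑ i, lam i * f i x : ℝ) : ℂ) =
          ((2 * Real.pi * ∑ i, lam i * f i x : ℝ) : ℂ) * Complex.I by push_cast; ring,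
          Complex.norm_exp_ofReal_mul_I]
    rw [abs_of_nonneg hba] at htriv
    have : 0 ≤ N * C := by positivity
    nlinarith
  · set μ : EuclideanSpace ℝ (Fin k) := ‖lam‖⁻¹ • lam with hμ
    have hμS : μ ∈ S := by
      rw [hS, mem_sphere_zero_iff_norm, hμ, norm_smul, norm_inv, norm_norm,
        inv_mul_cancel₀ hl.ne']
    set t : ℝ := 2 * Real.pi * ‖lam‖ with ht
    have hlt : ‖lam‖ ≤ t := by
      have := Real.pi_gt_three
      rw [ht]
      nlinarith
    have hphase : ∀ x, 2 * Real.pi * Complex.I * ((∑ i, lam i * f i x : ℝ) : ℂ) =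
        Complex.I * (t * G μ x : ℝ) := by
      intro x
      have : ∑ i, lam i * f i x = ‖lam‖ * G μ x := by
        simp only [hG, hμ, Finset.mul_sum, PiLp.smul_apply, smul_eq_mul]
        refine Finset.sum_congr rfl fun i _ => ?_
        field_simp
      rw [this, ht]
      push_cast
      ring
    simp only [hphase]
    have hcont : Continuous fun x => Complex.exp (Complex.I * (t * G μ x : ℝ)) := by
      have := (hGs μ 0).continuous
      fun_prop
    have hmain := norm_integral_le_of_short hcont hρ.le (a := a) (b := b) (D := C * t ^ (-δ))
      (fun p q hap hpq hqb hlen => hloc (μ, p) ⟨hμS, hap, hpq.trans hqb⟩ hμS p q hap hpq hqb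
        (by simpa using hρ.le) (by rwa [abs_of_nonneg (sub_nonneg.2 hpq)]) t (hge.trans hlt))
      N a le_rfl hab hNρ
    have hdecay : t ^ (-δ) ≤ ‖lam‖ ^ (-δ) :=
      Real.rpow_le_rpow_of_nonpos hl hlt (by linarith)
    calc _ ≤ N * (C * t ^ (-δ)) := hmain
      _ ≤ N * (C * ‖lam‖ ^ (-δ)) := by gcongr
      _ ≤ _ := by nlinarith
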